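/- arXiv:math/0011120 — 3 statements merged into one kernel-verified Lean document; each statement's English description precedes it below -/
import Mathlib

section
/- Let p be a prime and k a natural number. In the polynomial ring F_p[x_0,…,x_{k−1}], the determinant of the k×k matrix whose (i,j) entry is x_i^{p^j} (for 0 ≤ i, j < k) equals the product, over all j < k and all tuples (λ_0,…,λ_{j−1}) ∈ F_p^j, of the linear forms x_j + λ_0 x_0 + ⋯ + λ_{j−1} x_{j−1}. Equivalently, it equals the product of the linear forms Σ_i λ_i x_i over all nonzero λ ∈ F_p^k whose last nonzero entry is 1. -/
/-- A combination of `v` over `F_p`, raised to a power of `p`. -/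
theorem sum_smul_pow_prime_pow {p : ℕ} [Fact p.Prime] {R ι : Type*} [CommRing R]
    [Algebra (ZMod p) R] (s : Finset ι) (lam : ι → ZMod p) (v : ι → R) (j : ℕ) :
    (∑ i ∈ s, lam i • v i) ^ p ^ j = ∑ i ∈ s, lam i • v i ^ p ^ j := by
  rcases subsingleton_or_nontrivial R with _ | _
  · exact Subsingleton.elim _ _
  have : CharP R p := charP_of_injective_algebraMap (algebraMap (ZMod p) R).injective p
  rw [sum_pow_char_pow]
  simp only [Algebra.smul_def, mul_pow, ← map_pow, ZMod.pow_card_pow]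

/-- The Moore determinant, with one row for each entry of `v`. -/
def mooreDet {R : Type*} [CommRing R] (p : ℕ) {k : ℕ} (v : Fin k → R) : R :=
  Matrix.det (Matrix.of fun i j : Fin k => v i ^ p ^ (j : ℕ))

/-- A Moore determinant vanishes when its last entry is a combination of the others. -/
theorem mooreDet_snoc_neg_sum {p : ℕ} [Fact p.Prime] {R : Type*} [CommRing R] [IsDomain R]
    [Algebra (ZMod p) R] {k : ℕ} (v : Fin k → R) (lam : Fin k → ZMod p) :
    mooreDet p (Fin.snoc v (-∑ i, lam i • v i) : Fin (k + 1) → R) = 0 := by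
  refine Matrix.exists_vecMul_eq_zero_iff.mp
    ⟨Fin.snoc (fun i => algebraMap (ZMod p) R (lam i)) 1, fun h => ?_, ?_⟩
  · simpa using congrFun h (Fin.last k)
  · ext j
    have h := sum_smul_pow_prime_pow Finset.univ (fun i => -lam i) v j
    simp only [neg_smul, Finset.sum_neg_distrib] at h
    simp only [Algebra.smul_def] at h
    simp [Matrix.vecMul, dotProduct, Fin.sum_univ_castSucc, h, Algebra.smul_def]

open Polynomial in
/-- Expansion of a Moore determinant along its last row, as a polynomial in the last entry. -/
theorem exists_polynomial_eval_eq_mooreDet {p : ℕ} (hp : 1 < p) {R : Type*} [CommRing R]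
    {k : ℕ} (v : Fin k → R) :
    ∃ F : R[X], (∀ t, F.eval t = mooreDet p (Fin.snoc v t : Fin (k + 1) → R)) ∧
      (F - C (mooreDet p v) * X ^ p ^ k).degree < ((p ^ k : ℕ) : WithBot ℕ) := by
  let c (j : Fin (k + 1)) : R :=
    (-1) ^ (k + j : ℕ) * Matrix.det (Matrix.of fun a b : Fin k => v a ^ p ^ (j.succAbove b : ℕ))
  have hc : c (Fin.last k) = mooreDet p v := by
    simp [c, mooreDet, ← two_mul]
  refine ⟨∑ j, C (c j) * X ^ p ^ (j : ℕ), fun t => ?_, ?_⟩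
  · rw [mooreDet, Matrix.det_succ_row _ (Fin.last k), eval_finsetSum]
    refine Finset.sum_congr rfl fun j _ => ?_
    simp only [eval_mul, eval_C, eval_pow, eval_X, c, Matrix.of_apply, Fin.snoc_last,
      Fin.val_last, Fin.succAbove_last]
    rw [mul_right_comm]
    congr 2
    ext a b
    simp
  · rw [Fin.sum_univ_castSucc, hc, Fin.val_last, add_sub_cancel_right]
    refine (degree_sum_le _ _).trans_lt ((Finset.sup_lt_iff (WithBot.bot_lt_coe _)).mpr
      fun j _ => (degree_C_mul_X_pow_le _ _).trans_lt ?_)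
    exact_mod_cast Nat.pow_lt_pow_right hp j.isLt

open Polynomial in
theorem mooreDet_snoc {p : ℕ} [Fact p.Prime] {R : Type*} [CommRing R] [IsDomain R]
    [Algebra (ZMod p) R] {k : ℕ} {v : Fin k → R} (hv : LinearIndependent (ZMod p) v) (t : R) :
    mooreDet p (Fin.snoc v t : Fin (k + 1) → R) =
      mooreDet p v * ∏ lam : Fin k → ZMod p, (t + ∑ i, lam i • v i) := by
  obtain ⟨F, hF, hdeg⟩ :=
    exists_polynomial_eval_eq_mooreDet (Fact.out : p.Prime).one_lt v
  let P : R[X] := ∏ lam : Fin k → ZMod p, (X + C (∑ i, lam i • v i))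
  have hcard : (Finset.univ : Finset (Fin k → ZMod p)).card = p ^ k := by
    simp [ZMod.card]
  have hPm : P.Monic := monic_prod_of_monic _ _ fun _ _ => monic_X_add_C _
  have hPd : P.degree = ((p ^ k : ℕ) : WithBot ℕ) := by
    rw [degree_prod, Finset.sum_congr rfl fun _ _ => degree_X_add_C _]
    simp [ZMod.card]
  have hPX : (P - X ^ p ^ k).degree < ((p ^ k : ℕ) : WithBot ℕ) := by
    rw [← hPd]
    exact degree_sub_lt_left (by rw [hPd, degree_X_pow]) hPm.ne_zero
      (hPm.trans (monic_X_pow _).symm)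
  have hFP : F = C (mooreDet p v) * P := by
    refine eq_of_degree_sub_lt_of_eval_index_eq (s := Finset.univ)
      (v := fun lam : Fin k → ZMod p => -∑ i, lam i • v i) ?_ ?_ ?_
    · intro a _ b _ hab
      exact linearIndependent_iff_injective_fintypeLinearCombination.mp hv (by
        simpa [Fintype.linearCombination_apply] using hab)
    · rw [hcard, show F - C (mooreDet p v) * P = (F - C (mooreDet p v) * X ^ p ^ k) -
        C (mooreDet p v) * (P - X ^ p ^ k) by ring]
      refine (degree_sub_le _ _).trans_lt (max_lt hdeg (lt_of_le_of_lt ?_ hPX))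
      exact smul_eq_C_mul (mooreDet p v) ▸ degree_smul_le (mooreDet p v) (P - X ^ p ^ k)
    · intro lam _
      rw [hF, mooreDet_snoc_neg_sum, eval_mul, eval_prod,
        Finset.prod_eq_zero (Finset.mem_univ lam)
          (by rw [eval_add, eval_X, eval_C, neg_add_cancel]), mul_zero]
  rw [← hF, hFP]
  simp only [P, eval_mul, eval_prod, eval_add, eval_X, eval_C]

theorem mooreDet_eq_prod {p : ℕ} [Fact p.Prime] {R : Type*} [CommRing R] [IsDomain R]
    [Algebra (ZMod p) R] {k : ℕ} {v : Fin k → R} (hv : LinearIndependent (ZMod p) v) :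
    mooreDet p v = ∏ j : Fin k, ∏ lam : Fin (j : ℕ) → ZMod p,
      (v j + ∑ i : Fin (j : ℕ), lam i • v (Fin.castLE j.isLt.le i)) := by
  induction k with
  | zero => simp [mooreDet]
  | succ k ih =>
    have hinit : LinearIndependent (ZMod p) (Fin.init v) :=
      hv.comp _ (Fin.castSucc_injective k)
    rw [← Fin.snoc_init_self v, mooreDet_snoc hinit, ih hinit, Fin.snoc_init_self,
      Fin.prod_univ_castSucc]
    rfl

/-- Vectors whose last nonzero entry is `1`, sorted by the position `j` of that entry. -/
theorem prod_filter_last_nonzero_eq_one {A R M : Type*} [Ring A] [Nontrivial A] [Fintype A]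
    [DecidableEq A] [AddCommMonoid M] [Module A M] [CommMonoid R] {k : ℕ} (v : Fin k → M)
    (f : M → R) :
    ∏ lam ∈ Finset.univ.filter
        (fun lam : Fin k → A => ∃ j, lam j = 1 ∧ ∀ i, j < i → lam i = 0),
      f (∑ i, lam i • v i) =
    ∏ j : Fin k, ∏ lam : Fin (j : ℕ) → A,
      f (v j + ∑ i : Fin (j : ℕ), lam i • v (Fin.castLE j.isLt.le i)) := by
  let e (x : (j : Fin k) × (Fin (j : ℕ) → A)) (i : Fin k) : A :=
    if h : i < x.1 then x.2 ⟨i, h⟩ else if i = x.1 then 1 else 0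
  have he_lt (x) (i : Fin (x.1 : ℕ)) : e x (Fin.castLE x.1.isLt.le i) = x.2 i := by
    have h : Fin.castLE x.1.isLt.le i < x.1 := i.isLt
    simp [e, h]
  have he_self (x) : e x x.1 = 1 := by simp [e]
  have he_gt (x) (i) (h : x.1 < i) : e x i = 0 := by simp [e, h.not_gt, h.ne']
  rw [← Fintype.prod_sigma' fun (j : Fin k) (lam : Fin (j : ℕ) → A) =>
    f (v j + ∑ i : Fin (j : ℕ), lam i • v (Fin.castLE j.isLt.le i))]
  symm
  refine Finset.prod_bij (fun x _ => e x) ?_ ?_ ?_ ?_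
  · exact fun x _ => Finset.mem_filter.mpr ⟨Finset.mem_univ _, x.1, he_self x, he_gt x⟩
  · intro x _ y _ hxy
    have hle (x y) (hxy : e x = e y) : x.1 ≤ y.1 := by
      by_contra! h
      have := he_gt y x.1 h
      rw [← hxy, he_self] at this
      exact one_ne_zero this
    have h1 : x.1 = y.1 := (hle x y hxy).antisymm (hle y x hxy.symm)
    obtain ⟨j, a⟩ := x
    obtain ⟨j', b⟩ := y
    obtain rfl : j = j' := h1
    congr 1
    ext i
    exact (he_lt ⟨j, a⟩ i).symm.trans (by rw [hxy]; exact he_lt ⟨j, b⟩ i)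
  · intro lam hlam
    obtain ⟨j, hj, hgt⟩ := (Finset.mem_filter.mp hlam).2
    refine ⟨⟨j, fun i => lam (Fin.castLE j.isLt.le i)⟩, Finset.mem_univ _, ?_⟩
    ext i
    rcases lt_trichotomy i j with h | rfl | h
    · exact he_lt ⟨j, fun i => lam (Fin.castLE j.isLt.le i)⟩ ⟨i, h⟩
    · rw [he_self ⟨i, _⟩, hj]
    · rw [he_gt ⟨j, _⟩ i h, hgt i h]
  · intro x _
    congr 1
    have hlt : ∑ i ∈ Finset.Iio x.1, e x i • v i =
        ∑ i : Fin (x.1 : ℕ), x.2 i • v (Fin.castLE x.1.isLt.le i) := by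
      symm
      refine Finset.sum_bij (fun i _ => Fin.castLE x.1.isLt.le i) ?_ ?_ ?_ ?_
      · exact fun i _ => Finset.mem_Iio.mpr i.isLt
      · exact fun i _ i' _ h => Fin.castLE_injective _ h
      · exact fun i hi => ⟨⟨i, Fin.lt_def.mp (Finset.mem_Iio.mp hi)⟩, Finset.mem_univ _, rfl⟩
      · exact fun i _ => by rw [he_lt]
    rw [← hlt, ← Finset.sum_subset (Finset.subset_univ (Finset.Iic x.1)) fun i _ hi => by
      rw [he_gt x i (by simpa using hi), zero_smul], ← Finset.Iio_insert,
      Finset.sum_insert (by simp), he_self, one_smul]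

open MvPolynomial in
/-- The Moore determinant identity: `det (x_i ^ (p^j)) = β`, where `β` is the product
of the linear forms `x_j + λ_0 x_0 + ⋯ + λ_(j-1) x_(j-1)` over all `j < k` and all
tuples `λ ∈ F_p^j`; equivalently, the product of `Σ_i λ_i x_i` over all nonzero
`λ ∈ F_p^k` whose last nonzero entry is `1`. -/
theorem stmt_8 (p : ℕ) [Fact p.Prime] (k : ℕ) :
    (Matrix.det (Matrix.of fun i j : Fin k =>
        (X i : MvPolynomial (Fin k) (ZMod p)) ^ p ^ (j : ℕ)) =
      ∏ j : Fin k, ∏ lam : Fin (j : ℕ) → ZMod p,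
        (X j + ∑ i : Fin (j : ℕ), C (lam i) * X (Fin.castLE j.isLt.le i))) ∧
    (Matrix.det (Matrix.of fun i j : Fin k =>
        (X i : MvPolynomial (Fin k) (ZMod p)) ^ p ^ (j : ℕ)) =
      ∏ lam ∈ Finset.univ.filter
          (fun lam : Fin k → ZMod p => ∃ j, lam j = 1 ∧ ∀ i, j < i → lam i = 0),
        ∑ i : Fin k, C (lam i) * X i) := by
  have hX : LinearIndependent (ZMod p) (X : Fin k → MvPolynomial (Fin k) (ZMod p)) :=
    linearIndependent_X _ _
  have h := mooreDet_eq_prod hX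
  have h' := prod_filter_last_nonzero_eq_one (A := ZMod p)
    (X : Fin k → MvPolynomial (Fin k) (ZMod p)) id
  simp only [id, smul_eq_C_mul] at h h'
  exact ⟨h, h.trans h'.symm⟩
end

section
/- Let p be a prime and k a natural number, and let g be a k×k matrix over F_p. In the polynomial ring F_p[x_0,…,x_{k−1}], the determinant of the k×k matrix whose (i,j) entry is (Σ_{l<k} g_{il} x_l)^{p^j} equals det(g) times the determinant of the matrix whose (i,j) entry is x_i^{p^j}. -/
open MvPolynomial in
/-- Transformation law for the Moore determinant: substituting `x_i ↦ Σ_l g_(i l) x_l`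
multiplies `det (x_i ^ (p^j))` by `det g`. -/
theorem stmt_9 (p : ℕ) [Fact p.Prime] (k : ℕ) (g : Matrix (Fin k) (Fin k) (ZMod p)) :
    Matrix.det (Matrix.of fun i j : Fin k =>
        (∑ l : Fin k, C (g i l) * X l : MvPolynomial (Fin k) (ZMod p)) ^ p ^ (j : ℕ)) =
      C (Matrix.det g) *
        Matrix.det (Matrix.of fun i j : Fin k =>
          (X i : MvPolynomial (Fin k) (ZMod p)) ^ p ^ (j : ℕ)) := by
  rw [RingHom.map_det, ← Matrix.det_mul]
  congr 1
  ext1 i j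
  simp [Matrix.mul_apply, sum_pow_char_pow, mul_pow, ← C_pow, ZMod.pow_card_pow]
end

section
/- Let p be a prime and k a natural number, and let λ = (λ_0,…,λ_{k−1}) be a nonzero vector in F_p^k. Then in the polynomial ring F_p[x_0,…,x_{k−1}], the linear form λ_0 x_0 + ⋯ + λ_{k−1} x_{k−1} divides the determinant of the k×k matrix whose (i,j) entry is x_i^{p^j}. -/
theorem Matrix.dvd_det_of_forall_dvd_row {n R : Type*} [Fintype n] [DecidableEq n] [CommRing R]
    (A : Matrix n n R) (i : n) {a : R} (h : ∀ j, a ∣ A i j) : a ∣ A.det := by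
  choose v hv using h
  have hrow : A = A.updateRow i (a • v) := by
    rw [show a • v = A i from (funext hv).symm, Matrix.updateRow_eq_self]
  rw [hrow, Matrix.det_updateRow_smul]
  exact dvd_mul_right _ _

/-- In an `F_p`-algebra, taking `F_p`-linear combinations commutes with iterated Frobenius. -/
theorem ZMod.sum_algebraMap_mul_pow_char_pow {p : ℕ} [Fact p.Prime] {ι R : Type*} [CommRing R]
    [CharP R p] [Algebra (ZMod p) R] (s : Finset ι) (c : ι → ZMod p) (x : ι → R) (n : ℕ) :
    (∑ i ∈ s, algebraMap (ZMod p) R (c i) * x i) ^ p ^ n =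
      ∑ i ∈ s, algebraMap (ZMod p) R (c i) * x i ^ p ^ n := by
  rw [sum_pow_char_pow]
  simp_rw [mul_pow, ← map_pow, ZMod.pow_card_pow]

open MvPolynomial in
/-- Every nonzero linear form `Σ_i λ_i x_i` over `F_p` divides the Moore determinant
`det (x_i ^ (p^j))`. -/
theorem stmt_10 (p : ℕ) [Fact p.Prime] (k : ℕ) (lam : Fin k → ZMod p) (hlam : lam ≠ 0) :
    (∑ i : Fin k, C (lam i) * X i : MvPolynomial (Fin k) (ZMod p)) ∣
      Matrix.det (Matrix.of fun i j : Fin k =>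
        (X i : MvPolynomial (Fin k) (ZMod p)) ^ p ^ (j : ℕ)) := by
  obtain ⟨i₀, hi₀⟩ := Function.ne_iff.mp hlam
  have hunit : IsUnit (C (lam i₀) : MvPolynomial (Fin k) (ZMod p)) :=
    (isUnit_iff_ne_zero.mpr hi₀).map C
  rw [← hunit.dvd_mul_left, ← smul_eq_mul,
    ← Matrix.det_updateRow_sum _ i₀ fun i => (C (lam i) : MvPolynomial (Fin k) (ZMod p))]
  refine Matrix.dvd_det_of_forall_dvd_row _ i₀ fun j => ?_
  have hfrob := ZMod.sum_algebraMap_mul_pow_char_pow Finset.univ lam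
    (X : Fin k → MvPolynomial (Fin k) (ZMod p)) j
  simp only [algebraMap_eq] at hfrob
  simp only [Matrix.updateRow_self, Finset.sum_apply, Pi.smul_apply, Matrix.of_apply, smul_eq_mul,
    ← hfrob]
  exact dvd_pow_self _ (pow_ne_zero _ (Fact.out : p.Prime).ne_zero)
end
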